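/- Let 0 < k̲ < k̄, let φ_m(k) = k^{m−1} e^{k − (k̄ + k̲)/2} for m ≥ 1, and let N ≥ 1. Suppose Ψ_1, …, Ψ_N : [k̲, k̄] → ℝ are continuously differentiable, orthonormal with respect to ⟨f, g⟩ = ∫_{k̲}^{k̄} f(k) g(k) dk, and satisfy span{Ψ_1, …, Ψ_m} = span{φ_1, …, φ_m} for every m ≤ N. Then the N × N real matrix 𝒮_N with entries S_{mn} = ∫_{k̲}^{k̄} Ψ_n′(k) Ψ_m(k) dk is invertible. -/

import Mathlib

open MeasureTheory

noncomputable section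

/-- `φ_m(k) = k^(m-1) exp(k - (k̄+k̲)/2)`. -/
def phi (ka kb : ℝ) (m : ℕ) (k : ℝ) : ℝ := k ^ (m - 1) * Real.exp (k - (kb + ka) / 2)

/-- Restriction of a function on `ℝ` to the interval `[ka, kb]`. -/
def res (ka kb : ℝ) (f : ℝ → ℝ) : Set.Icc ka kb → ℝ := fun x => f x

/-- Differentiation minus the identity lowers the index: `φ_n' - φ_n = (n - 1) φ_{n-1}`. -/
theorem hasDerivAt_phi (ka kb : ℝ) (n : ℕ) (k : ℝ) :
    HasDerivAt (phi ka kb n) (((n - 1 : ℕ) : ℝ) * phi ka kb (n - 1) k + phi ka kb n k) k := by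
  have h : HasDerivAt (fun k : ℝ => Real.exp (k - (kb + ka) / 2))
      (Real.exp (k - (kb + ka) / 2) * 1) k :=
    ((hasDerivAt_id' k).sub_const ((kb + ka) / 2)).exp
  refine ((hasDerivAt_pow (n - 1) k).mul h).congr_deriv ?_
  simp only [phi]
  ring

/-- A function in the span of `φ_1, …, φ_n` on `[ka, kb]` has an extension whose derivative
differs from it by an element of the span of `φ_1, …, φ_{n-1}`. -/
theorem exists_hasDerivAt_of_mem_span_phi (ka kb : ℝ) (n : ℕ) {u : Set.Icc ka kb → ℝ}
    (hu : u ∈ Submodule.span ℝ ((fun j => res ka kb (phi ka kb j)) '' Set.Icc 1 n)) :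
    ∃ F G : ℝ → ℝ, (∀ k, HasDerivAt F (G k + F k) k) ∧ res ka kb F = u ∧
      res ka kb G ∈
        Submodule.span ℝ ((fun j => res ka kb (phi ka kb j)) '' Set.Icc 1 (n - 1)) := by
  induction hu using Submodule.span_induction with
  | mem u hu =>
    obtain ⟨j, ⟨hj1, hjn⟩, rfl⟩ := hu
    refine ⟨phi ka kb j, ((j - 1 : ℕ) : ℝ) • phi ka kb (j - 1), hasDerivAt_phi ka kb j, rfl, ?_⟩
    change ((j - 1 : ℕ) : ℝ) • res ka kb (phi ka kb (j - 1)) ∈ _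
    rcases hj1.eq_or_lt with rfl | hj
    · simp
    · exact Submodule.smul_mem _ _
        (Submodule.subset_span ⟨j - 1, ⟨by omega, by omega⟩, rfl⟩)
  | zero => exact ⟨0, 0, fun k => by simp, rfl, zero_mem _⟩
  | add u v _ _ hu hv =>
    obtain ⟨F, G, hF, rfl, hG⟩ := hu
    obtain ⟨F', G', hF', rfl, hG'⟩ := hv
    refine ⟨F + F', G + G', fun k => ?_, rfl, add_mem hG hG'⟩
    refine ((hF k).add (hF' k)).congr_deriv ?_
    simp only [Pi.add_apply]
    ring
  | smul c u _ hu =>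
    obtain ⟨F, G, hF, rfl, hG⟩ := hu
    refine ⟨c • F, c • G, fun k => ?_, rfl, Submodule.smul_mem _ c hG⟩
    refine ((hF k).const_smul c).congr_deriv ?_
    simp only [Pi.smul_apply, smul_eq_mul]
    ring

/-- If `w` is orthogonal to every member of a family, it is orthogonal to its span. -/
theorem integral_mul_eq_zero_of_mem_span {ka kb : ℝ} {ι : Type*} {s : Set ι} {Ψ : ι → ℝ → ℝ}
    {w G : ℝ → ℝ} (hint : ∀ j ∈ s, IntegrableOn (fun k => Ψ j k * w k) (Set.Ioo ka kb))
    (horth : ∀ j ∈ s, ∫ k in Set.Ioo ka kb, Ψ j k * w k = 0)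
    (hG : res ka kb G ∈ Submodule.span ℝ ((fun j => res ka kb (Ψ j)) '' s)) :
    IntegrableOn (fun k => G k * w k) (Set.Ioo ka kb) ∧
      ∫ k in Set.Ioo ka kb, G k * w k = 0 := by
  have key : ∃ H : ℝ → ℝ, res ka kb H = res ka kb G ∧
      IntegrableOn (fun k => H k * w k) (Set.Ioo ka kb) ∧
      ∫ k in Set.Ioo ka kb, H k * w k = 0 := by
    generalize res ka kb G = u at hG ⊢
    induction hG using Submodule.span_induction with
    | mem u hu =>
      obtain ⟨j, hj, rfl⟩ := hu
      exact ⟨Ψ j, rfl, hint j hj, horth j hj⟩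
    | zero => exact ⟨0, rfl, by simp, by simp⟩
    | add u v _ _ hu hv =>
      obtain ⟨F, rfl, hF, hF0⟩ := hu
      obtain ⟨F', rfl, hF', hF0'⟩ := hv
      refine ⟨F + F', rfl, ?_, ?_⟩ <;> simp only [Pi.add_apply, add_mul]
      · exact hF.add hF'
      · rw [integral_add hF hF', hF0, hF0', add_zero]
    | smul c u _ hu =>
      obtain ⟨F, rfl, hF, hF0⟩ := hu
      refine ⟨c • F, rfl, ?_, ?_⟩ <;> simp only [Pi.smul_apply, smul_eq_mul, mul_assoc]
      · exact hF.const_mul c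
      · rw [integral_const_mul, hF0, mul_zero]
  obtain ⟨H, hHG, hH, hH0⟩ := key
  have heq : Set.EqOn (fun k => H k * w k) (fun k => G k * w k) (Set.Ioo ka kb) := fun k hk =>
    congrArg (· * w k) (congrFun hHG ⟨k, Set.Ioo_subset_Icc_self hk⟩)
  exact ⟨hH.congr_fun heq measurableSet_Ioo,
    (setIntegral_congr_fun measurableSet_Ioo heq).symm.trans hH0⟩

/-- For the Gram–Schmidt orthonormalization `Ψ_n` of the family `φ_n`, the `N × N` matrix
`𝒮_N = (S_{mn}) = (⟨Ψ_n', Ψ_m⟩)` is invertible. -/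
theorem smatrix_invertible (ka kb : ℝ) (h0 : 0 < ka) (hab : ka < kb)
    (N : ℕ) (hN : 1 ≤ N) (Ψ DΨ : ℕ → ℝ → ℝ)
    (hdiff : ∀ n, 1 ≤ n → n ≤ N → ∀ k ∈ Set.Icc ka kb,
        HasDerivWithinAt (Ψ n) (DΨ n k) (Set.Icc ka kb) k)
    (hcont : ∀ n, 1 ≤ n → n ≤ N → ContinuousOn (DΨ n) (Set.Icc ka kb))
    (horth : ∀ m, 1 ≤ m → m ≤ N → ∀ n, 1 ≤ n → n ≤ N →
        (∫ k in Set.Ioo ka kb, Ψ m k * Ψ n k) = if m = n then 1 else 0)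
    (hspan : ∀ m, 1 ≤ m → m ≤ N →
        Submodule.span ℝ ((fun j => res ka kb (Ψ j)) '' Set.Icc 1 m) =
        Submodule.span ℝ ((fun j => res ka kb (phi ka kb j)) '' Set.Icc 1 m)) :
    IsUnit (Matrix.of (fun m n : Fin N =>
      ∫ k in Set.Ioo ka kb, DΨ (n + 1) k * Ψ (m + 1) k) : Matrix (Fin N) (Fin N) ℝ) := by
  have hint : ∀ m, 1 ≤ m → m ≤ N → ∀ n, 1 ≤ n → n ≤ N →
      IntegrableOn (fun k => Ψ m k * Ψ n k) (Set.Ioo ka kb) := fun m hm hmN n hn hnN =>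
    (ContinuousOn.integrableOn_Icc
      (ContinuousOn.mul (fun k hk => (hdiff m hm hmN k hk).continuousWithinAt)
        fun k hk => (hdiff n hn hnN k hk).continuousWithinAt)).mono_set Set.Ioo_subset_Icc_self
  have key : ∀ n, 1 ≤ n → n ≤ N → ∀ m, n ≤ m → m ≤ N →
      ∫ k in Set.Ioo ka kb, DΨ n k * Ψ m k = if n = m then 1 else 0 := by
    intro n hn hnN m hnm hmN
    have hmem : res ka kb (Ψ n) ∈
        Submodule.span ℝ ((fun j => res ka kb (phi ka kb j)) '' Set.Icc 1 n) :=
      hspan n hn hnN ▸ Submodule.subset_span ⟨n, ⟨hn, le_rfl⟩, rfl⟩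
    obtain ⟨F, G, hF, hFΨ, hG⟩ := exists_hasDerivAt_of_mem_span_phi ka kb n hmem
    have hFΨ' : Set.EqOn (Ψ n) F (Set.Icc ka kb) := fun k hk => (congrFun hFΨ ⟨k, hk⟩).symm
    have hG' : res ka kb G ∈
        Submodule.span ℝ ((fun j => res ka kb (Ψ j)) '' Set.Icc 1 (n - 1)) := by
      rcases hn.eq_or_lt with rfl | hn'
      · simpa using hG
      · rwa [hspan (n - 1) (by omega) (by omega)]
    obtain ⟨hGi, hG0⟩ := integral_mul_eq_zero_of_mem_span (w := Ψ m)
      (fun j hj => hint j hj.1 (by have := hj.2; omega) m (hn.trans hnm) hmN)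
      (fun j hj => by
        have := hj.2
        rw [horth j hj.1 (by omega) m (hn.trans hnm) hmN, if_neg (by omega)]) hG'
    have hD : Set.EqOn (fun k => DΨ n k * Ψ m k) (fun k => G k * Ψ m k + Ψ n k * Ψ m k)
        (Set.Ioo ka kb) := fun k hk => by
      have hk' := Set.Ioo_subset_Icc_self hk
      have hderiv := ((uniqueDiffOn_Icc hab) k hk').eq_deriv _ (hdiff n hn hnN k hk')
        ((hF k).hasDerivWithinAt.congr hFΨ' (hFΨ' hk'))
      simp only [hderiv, ← hFΨ' hk', add_mul]
    rw [setIntegral_congr_fun measurableSet_Ioo hD,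
      integral_add hGi (hint n hn hnN m (hn.trans hnm) hmN), hG0, zero_add,
      horth n hn hnN m (hn.trans hnm) hmN]
  rw [Matrix.isUnit_iff_isUnit_det, Matrix.det_of_isUpperTriangular]
  · rw [Finset.prod_eq_one fun i _ => ?_]
    · exact isUnit_one
    · rw [Matrix.of_apply, key _ (by omega) (by omega) _ le_rfl (by omega), if_pos rfl]
  · intro m n hnm
    have hlt : (n : ℕ) < m := hnm
    rw [Matrix.of_apply, key _ (by omega) (by omega) _ (by omega) (by omega), if_neg (by omega)]
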